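/- arXiv:math/0401431 — 8 statements merged into one kernel-verified Lean document; each statement's English description precedes it below -/
import Mathlib

section
/- Let p : M̃ → M and q : Ñ → N be covering maps with Ñ preconnected, f, g : M → N continuous, and f̃, g̃ : M̃ → Ñ lifts of f and g (q ∘ f̃ = f ∘ p and q ∘ g̃ = g ∘ p). Let x̃₀ ∈ M̃ satisfy f̃(x̃₀) = g̃(x̃₀), let α be a deck transformation of p, and let β, β′ be deck transformations of q with f̃ ∘ α = β ∘ f̃ and g̃ ∘ α = β′ ∘ g̃. Then f̃(α(x̃₀)) = g̃(α(x̃₀)) if and only if β = β′. -/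
/-- A deck transformation of a covering map `p : X → Y` is a self-homeomorphism `γ` of the
total space satisfying `p ∘ γ = p`. -/
def IsDeckTransformation {X Y : Type*} [TopologicalSpace X] [TopologicalSpace Y]
    (p : X → Y) (γ : X ≃ₜ X) : Prop :=
  ∀ x, p (γ x) = p x

/-- Two deck transformations of a covering map with preconnected total space that agree at a
point are equal. -/
theorem IsDeckTransformation.eq_of_apply_eq {X Y : Type*} [TopologicalSpace X]
    [TopologicalSpace Y] [PreconnectedSpace X] {q : X → Y} {γ γ' : X ≃ₜ X}
    (hγ : IsDeckTransformation q γ) (hq : IsCoveringMap q) (hγ' : IsDeckTransformation q γ')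
    {x : X} (h : γ x = γ' x) : γ = γ' :=
  DFunLike.coe_injective <| hq.eq_of_comp_eq γ.continuous γ'.continuous
    (funext fun y ↦ (hγ y).trans (hγ' y).symm) x h

/-- Lemma 3.1 (lifcoin): given covering maps `p`, `q` with `N'` preconnected, lifts `f'`, `g'`
of `f`, `g`, a coincidence point `x₀'` of `(f', g')`, a deck transformation `α` of `p` and deck
transformations `β`, `β'` of `q` with `f' ∘ α = β ∘ f'` and `g' ∘ α = β' ∘ g'`, the point
`α x₀'` is a coincidence of `(f', g')` if and only if `β = β'`. -/
theorem stmt1 {M' M N' N : Type*} [TopologicalSpace M'] [TopologicalSpace M]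
    [TopologicalSpace N'] [TopologicalSpace N] [PreconnectedSpace N']
    {p : M' → M} {q : N' → N} (hp : IsCoveringMap p) (hq : IsCoveringMap q)
    {f g : M → N} (hf : Continuous f) (hg : Continuous g)
    {f' g' : M' → N'} (hf' : Continuous f') (hg' : Continuous g')
    (hliftf : q ∘ f' = f ∘ p) (hliftg : q ∘ g' = g ∘ p)
    {x₀' : M'} (hx₀' : f' x₀' = g' x₀')
    {α : M' ≃ₜ M'} (hα : IsDeckTransformation p α)
    {β β' : N' ≃ₜ N'} (hβ : IsDeckTransformation q β) (hβ' : IsDeckTransformation q β')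
    (hfα : f' ∘ α = β ∘ f') (hgα : g' ∘ α = β' ∘ g') :
    f' (α x₀') = g' (α x₀') ↔ β = β' := by
  have hf₀ : f' (α x₀') = β (f' x₀') := congr_fun hfα x₀'
  have hg₀ : g' (α x₀') = β' (f' x₀') := hx₀' ▸ congr_fun hgα x₀'
  rw [hf₀, hg₀]
  exact ⟨fun h ↦ hβ.eq_of_apply_eq hq hβ' h, fun h ↦ by rw [h]⟩
end

section
/- Let p : M̃ → M and q : Ñ → N be covering maps with M̃ and Ñ preconnected, f, g : M → N continuous, and f̃, g̃ : M̃ → Ñ lifts of f and g. Assume the deck transformation group of q acts transitively on every fiber of q. Let x̃₀ ∈ Coin(f̃, g̃), set x₀ = p(x̃₀), and assume the deck transformation group of p acts transitively on the fiber p⁻¹(x₀). Then the map γ ↦ γ(x̃₀) is a bijection from the set of deck transformations γ of p for which there exists a single deck transformation β of q with f̃ ∘ γ = β ∘ f̃ and g̃ ∘ γ = β ∘ g̃, onto the set p⁻¹(x₀) ∩ Coin(f̃, g̃). -/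
/-- If a lift `u'` of `u` and deck transformations `γ` of `p` and `β` of `q` satisfy
`u' (γ x) = β (u' x)` at one point `x`, then `u' ∘ γ = β ∘ u'`. -/
theorem IsCoveringMap.comp_deck_eq_deck_comp {M' M N' N : Type*} [TopologicalSpace M']
    [TopologicalSpace N'] [TopologicalSpace N] [TopologicalSpace M] [PreconnectedSpace M']
    {p : M' → M} {q : N' → N} (hq : IsCoveringMap q) {u : M → N} {u' : M' → N'}
    (hu' : Continuous u') (hlift : q ∘ u' = u ∘ p)
    {γ : M' ≃ₜ M'} (hγ : IsDeckTransformation p γ)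
    {β : N' ≃ₜ N'} (hβ : IsDeckTransformation q β)
    {x : M'} (hx : u' (γ x) = β (u' x)) : u' ∘ γ = β ∘ u' := by
  refine hq.eq_of_comp_eq (hu'.comp γ.continuous) (β.continuous.comp hu') ?_ x hx
  funext y
  have hlift' (z : M') : q (u' z) = u (p z) := congrFun hlift z
  simp only [Function.comp_apply, hlift', hγ y, hβ (u' y)]

/-- Corollary 3.2 (numcop): with `M'`, `N'` preconnected, the deck group of `q` transitive on
every fiber of `q`, a coincidence point `x₀'` of the lifts `(f', g')`, `x₀ = p x₀'`, and the
deck group of `p` transitive on the fiber `p⁻¹(x₀)`, the map `γ ↦ γ x₀'` is a bijection from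
the set of deck transformations `γ` of `p` for which a single deck transformation `β` of `q`
satisfies `f' ∘ γ = β ∘ f'` and `g' ∘ γ = β ∘ g'`, onto `p⁻¹(x₀) ∩ Coin(f', g')`. -/
theorem stmt2 {M' M N' N : Type*} [TopologicalSpace M'] [TopologicalSpace M]
    [TopologicalSpace N'] [TopologicalSpace N]
    [PreconnectedSpace M'] [PreconnectedSpace N']
    {p : M' → M} {q : N' → N} (hp : IsCoveringMap p) (hq : IsCoveringMap q)
    {f g : M → N} (hf : Continuous f) (hg : Continuous g)
    {f' g' : M' → N'} (hf' : Continuous f') (hg' : Continuous g')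
    (hliftf : q ∘ f' = f ∘ p) (hliftg : q ∘ g' = g ∘ p)
    (hqtrans : ∀ y y' : N', q y = q y' →
      ∃ β : N' ≃ₜ N', IsDeckTransformation q β ∧ β y = y')
    {x₀' : M'} (hx₀' : f' x₀' = g' x₀')
    (hptrans : ∀ x x' : M', p x = p x₀' → p x' = p x₀' →
      ∃ γ : M' ≃ₜ M', IsDeckTransformation p γ ∧ γ x = x') :
    Set.BijOn (fun γ : M' ≃ₜ M' => γ x₀')
      {γ : M' ≃ₜ M' | IsDeckTransformation p γ ∧
        ∃ β : N' ≃ₜ N', IsDeckTransformation q β ∧ f' ∘ γ = β ∘ f' ∧ g' ∘ γ = β ∘ g'}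
      (p ⁻¹' {p x₀'} ∩ {x : M' | f' x = g' x}) := by
  refine ⟨?_, ?_, ?_⟩
  · rintro γ ⟨hγ, β, -, hβf, hβg⟩
    refine ⟨hγ x₀', ?_⟩
    calc f' (γ x₀') = β (f' x₀') := congrFun hβf x₀'
      _ = β (g' x₀') := by rw [hx₀']
      _ = g' (γ x₀') := (congrFun hβg x₀').symm
  · rintro γ ⟨hγ, -⟩ δ ⟨hδ, -⟩ h
    refine Homeomorph.ext (congrFun (hp.eq_of_comp_eq γ.continuous δ.continuous ?_ x₀' h))
    funext x
    exact (hγ x).trans (hδ x).symm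
  · rintro x ⟨hx : p x = p x₀', hfg : f' x = g' x⟩
    obtain ⟨γ, hγ, rfl⟩ := hptrans x₀' x rfl hx
    have hqf : q (f' x₀') = q (f' (γ x₀')) := by
      have hlift (z : M') : q (f' z) = f (p z) := congrFun hliftf z
      rw [hlift, hlift, hx]
    obtain ⟨β, hβ, hβx⟩ := hqtrans _ _ hqf
    refine ⟨γ, ⟨hγ, β, hβ, ?_, ?_⟩, rfl⟩
    · exact hq.comp_deck_eq_deck_comp hf' hliftf hγ hβ hβx.symm
    · refine hq.comp_deck_eq_deck_comp hg' hliftg hγ hβ (x := x₀') ?_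
      rw [← hfg, ← hx₀', hβx]
end

section
/- Let p : M̃ → M and q : Ñ → N be covering maps, f, g : M → N continuous, and f̃, g̃ : M̃ → Ñ lifts of f and g. Let x̃₀, x̃₀′ ∈ Coin(f̃, g̃) with p(x̃₀) = p(x̃₀′) = x₀. Then there exists a path β̃ in M̃ from x̃₀ to x̃₀′ such that f̃ ∘ β̃ and g̃ ∘ β̃ are path-homotopic if and only if there exists a loop γ̄ in M based at x₀ such that (i) the lift of γ̄ through p starting at x̃₀ ends at x̃₀′, and (ii) f ∘ γ̄ and g ∘ γ̄ are path-homotopic (as loops at f(x₀) = g(x₀)). -/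
/-- Lemma 3.3 (samcla): let `p`, `q` be covering maps, `f'`, `g'` lifts of `f`, `g`, and
`x₀'`, `x₀''` coincidence points of `(f', g')` lying over the same point `x₀ = p x₀'`.
Then there is a path `β'` in `M'` from `x₀'` to `x₀''` with `f' ∘ β'` and `g' ∘ β'`
path-homotopic if and only if there is a loop `γ` in `M` at `x₀` whose lift through `p`
starting at `x₀'` ends at `x₀''` and such that `f ∘ γ` and `g ∘ γ` are path-homotopic. -/
theorem stmt3 {M' M N' N : Type*} [TopologicalSpace M'] [TopologicalSpace M]
    [TopologicalSpace N'] [TopologicalSpace N]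
    {p : M' → M} {q : N' → N} (hp : IsCoveringMap p) (hq : IsCoveringMap q)
    {f g : M → N} (hf : Continuous f) (hg : Continuous g)
    {f' g' : M' → N'} (hf' : Continuous f') (hg' : Continuous g')
    (hliftf : q ∘ f' = f ∘ p) (hliftg : q ∘ g' = g ∘ p)
    {x₀' x₀'' : M'} (hc₀ : f' x₀' = g' x₀') (hc₀' : f' x₀'' = g' x₀'')
    (hfiber : p x₀' = p x₀'')
    (hx₀ : f (p x₀') = g (p x₀')) :
    (∃ β' : Path x₀' x₀'',
        (β'.map hf').Homotopic ((β'.map hg').cast hc₀ hc₀')) ↔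
    (∃ γ : Path (p x₀') (p x₀'),
        (∃ γ' : Path x₀' x₀'', ∀ t, p (γ' t) = γ t) ∧
        (γ.map hf).Homotopic ((γ.map hg).cast hx₀ hx₀)) := by
  have key : ∀ (β : Path x₀' x₀'') (γ : Path (p x₀') (p x₀')), (∀ t, p (β t) = γ t) →
      ((β.map hf').Homotopic ((β.map hg').cast hc₀ hc₀') ↔
        (γ.map hf).Homotopic ((γ.map hg).cast hx₀ hx₀)) := by
    intro β γ h
    have ef : (⟨q, hq.continuous⟩ : C(N', N)).comp (β.map hf').toContinuousMap =
        (γ.map hf).toContinuousMap :=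
      ContinuousMap.ext fun t => (congrFun hliftf (β t)).trans (congrArg f (h t))
    have eg : (⟨q, hq.continuous⟩ : C(N', N)).comp
        ((β.map hg').cast hc₀ hc₀').toContinuousMap =
        ((γ.map hg).cast hx₀ hx₀).toContinuousMap :=
      ContinuousMap.ext fun t => (congrFun hliftg (β t)).trans (congrArg g (h t))
    have hrel := hq.homotopicRel_iff_comp (f₀ := (β.map hf').toContinuousMap)
      (f₁ := ((β.map hg').cast hc₀ hc₀').toContinuousMap) (S := {0, 1})
      ⟨0, Or.inl rfl, by simp [hc₀]⟩
    rw [ef, eg] at hrel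
    exact hrel
  constructor
  · rintro ⟨β, hβ⟩
    let γ : Path (p x₀') (p x₀') := (β.map hp.continuous).cast rfl hfiber
    exact ⟨γ, ⟨β, fun _ => rfl⟩, (key β γ fun _ => rfl).1 hβ⟩
  · rintro ⟨γ, ⟨β, h⟩, hγ⟩
    exact ⟨β, (key β γ h).2 hγ⟩
end

section
/- Let p : M̃ → M and q : Ñ → N be covering maps, f, g : M → N continuous, and f̃, g̃ : M̃ → Ñ lifts of f and g. Let x₀, x₁ ∈ Coin(f, g) and let ᾱ be a path in M from x₀ to x₁ such that f ∘ ᾱ and g ∘ ᾱ are path-homotopic. Let x̃₀ ∈ Coin(f̃, g̃) with p(x̃₀) = x₀, and let α̃ be the lift of ᾱ through p with α̃(0) = x̃₀. Then: (i) f̃(α̃(1)) = g̃(α̃(1)), i.e. α̃(1) ∈ Coin(f̃, g̃); (ii) p(α̃(1)) = x₁; and (iii) f̃ ∘ α̃ and g̃ ∘ α̃ are path-homotopic, so that x̃₀ and α̃(1) are Nielsen related for (f̃, g̃). -/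
/-- Lemma 3.7 (lifpat), parts (i)–(iii): let `p`, `q` be covering maps, `f'`, `g'` lifts of
`f`, `g`, `x₀`, `x₁` coincidence points of `(f, g)`, `α` a path from `x₀` to `x₁` with
`f ∘ α` and `g ∘ α` path-homotopic, `x₀'` a coincidence of `(f', g')` over `x₀` and `α'`
the lift of `α` through `p` starting at `x₀'`, with endpoint `x₁'`. Then `x₁'` is a
coincidence of `(f', g')`, it lies over `x₁`, and `f' ∘ α'` and `g' ∘ α'` are
path-homotopic (so `x₀'` and `x₁'` are Nielsen related for `(f', g')`). -/
theorem stmt5 {M' M N' N : Type*} [TopologicalSpace M'] [TopologicalSpace M]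
    [TopologicalSpace N'] [TopologicalSpace N]
    {p : M' → M} {q : N' → N} (hp : IsCoveringMap p) (hq : IsCoveringMap q)
    {f g : M → N} (hf : Continuous f) (hg : Continuous g)
    {f' g' : M' → N'} (hf' : Continuous f') (hg' : Continuous g')
    (hliftf : q ∘ f' = f ∘ p) (hliftg : q ∘ g' = g ∘ p)
    {x₀ x₁ : M} (hx₀ : f x₀ = g x₀) (hx₁ : f x₁ = g x₁)
    (α : Path x₀ x₁) (hα : (α.map hf).Homotopic ((α.map hg).cast hx₀ hx₁))
    {x₀' x₁' : M'} (hc₀ : f' x₀' = g' x₀') (hp₀ : p x₀' = x₀)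
    (α' : Path x₀' x₁') (hαlift : ∀ t, p (α' t) = α t) :
    ∃ hc₁ : f' x₁' = g' x₁', p x₁' = x₁ ∧
      (α'.map hf').Homotopic ((α'.map hg').cast hc₀ hc₁) := by
  have hx : p x₁' = x₁ := by simpa using hαlift 1
  obtain ⟨H⟩ := hα
  have hF : q ∘ (α'.map hf').toContinuousMap = (α.map hf).toContinuousMap :=
    funext fun t => (congrFun hliftf (α' t)).trans (congrArg f (hαlift t))
  have hG : q ∘ (α'.map hg').toContinuousMap =
      ((α.map hg).cast hx₀ hx₁).toContinuousMap :=
    funext fun t => (congrFun hliftg (α' t)).trans (congrArg g (hαlift t))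
  have K : (α'.map hf').toContinuousMap.HomotopyRel (α'.map hg').toContinuousMap {0, 1} :=
    hq.liftHomotopyRel H ⟨0, by simp, by simpa using hc₀⟩ hF hG
  have hc₁ : f' x₁' = g' x₁' := by
    simpa using K.fst_eq_snd (x := 1) (by simp)
  exact ⟨hc₁, hx, ⟨K⟩⟩
end

section
/- Let p : M̃ → M and q : Ñ → N be covering maps, f, g : M → N continuous, and f̃, g̃ : M̃ → Ñ lifts of f and g. If C̃ ⊆ Coin(f̃, g̃) is an equivalence class of the Nielsen relation on Coin(f̃, g̃) (a Nielsen coincidence class of the pair (f̃, g̃)), then p(C̃) is an equivalence class of the Nielsen relation on Coin(f, g) (a Nielsen coincidence class of the pair (f, g)). -/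
/-- Two points `x`, `y` are Nielsen related for the pair `(f, g)` if they are coincidence
points and there is a path `w` from `x` to `y` such that `f ∘ w` and `g ∘ w` are
path-homotopic. -/
def NielsenRelated {X Y : Type*} [TopologicalSpace X] [TopologicalSpace Y]
    {f g : X → Y} (hf : Continuous f) (hg : Continuous g) (x y : X) : Prop :=
  ∃ (hx : f x = g x) (hy : f y = g y) (w : Path x y),
    (w.map hf).Homotopic ((w.map hg).cast hx hy)

/-- `C` is a Nielsen coincidence class of the pair `(f, g)`: an equivalence class of the
Nielsen relation on the coincidence set, i.e. `C` is the set of points Nielsen related to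
some coincidence point `x`. -/
def IsNielsenClass {X Y : Type*} [TopologicalSpace X] [TopologicalSpace Y]
    {f g : X → Y} (hf : Continuous f) (hg : Continuous g) (C : Set X) : Prop :=
  ∃ x : X, f x = g x ∧ C = {y : X | NielsenRelated hf hg x y}

/-- Nielsen relatedness in terms of homotopy relative to the endpoints of maps on the interval;
agreement at the terminal point is automatic. -/
theorem nielsenRelated_iff_homotopicRel {X Y : Type*} [TopologicalSpace X]
    [TopologicalSpace Y] {f g : X → Y} (hf : Continuous f) (hg : Continuous g) (x y : X) :
    NielsenRelated hf hg x y ↔ ∃ w : C(unitInterval, X), w 0 = x ∧ w 1 = y ∧ f x = g x ∧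
      ContinuousMap.HomotopicRel ((ContinuousMap.mk f hf).comp w)
        ((ContinuousMap.mk g hg).comp w) {0, 1} := by
  constructor
  · rintro ⟨hx, hy, w, h⟩
    exact ⟨w, w.source, w.target, hx, h⟩
  · rintro ⟨w, rfl, rfl, hx, h⟩
    refine ⟨hx, ?_, ⟨w, rfl, rfl⟩, h⟩
    exact h.fst_eq_snd (by simp)

/-- Theorem 3.8, first assertion: if `C'` is a Nielsen coincidence class of the pair of
lifts `(f', g')`, then `p '' C'` is a Nielsen coincidence class of `(f, g)`. -/
theorem stmt7 {M' M N' N : Type*} [TopologicalSpace M'] [TopologicalSpace M]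
    [TopologicalSpace N'] [TopologicalSpace N]
    {p : M' → M} {q : N' → N} (hp : IsCoveringMap p) (hq : IsCoveringMap q)
    {f g : M → N} (hf : Continuous f) (hg : Continuous g)
    {f' g' : M' → N'} (hf' : Continuous f') (hg' : Continuous g')
    (hliftf : q ∘ f' = f ∘ p) (hliftg : q ∘ g' = g ∘ p)
    {C' : Set M'} (hC' : IsNielsenClass hf' hg' C') :
    IsNielsenClass hf hg (p '' C') := by
  have hF : ∀ z, q (f' z) = f (p z) := congrFun hliftf
  have hG : ∀ z, q (g' z) = g (p z) := congrFun hliftg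
  have hcomp : ∀ (w' : C(unitInterval, M')) (w : C(unitInterval, M)), p ∘ w' = w →
      f' (w' 0) = g' (w' 0) →
      (((ContinuousMap.mk f' hf').comp w').HomotopicRel ((ContinuousMap.mk g' hg').comp w')
          {0, 1} ↔
        ((ContinuousMap.mk f hf).comp w).HomotopicRel ((ContinuousMap.mk g hg).comp w)
          {0, 1}) := by
    intro w' w hw h0
    have hw' : ∀ t, p (w' t) = w t := congrFun hw
    rw [hq.homotopicRel_iff_comp ⟨0, by simp, h0⟩]
    have ef : (ContinuousMap.mk q hq.continuous).comp ((ContinuousMap.mk f' hf').comp w') =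
        (ContinuousMap.mk f hf).comp w := by
      ext t; simp [hF, hw']
    have eg : (ContinuousMap.mk q hq.continuous).comp ((ContinuousMap.mk g' hg').comp w') =
        (ContinuousMap.mk g hg).comp w := by
      ext t; simp [hG, hw']
    rw [← ef, ← eg]
  obtain ⟨x, hx, rfl⟩ := hC'
  have hpx : f (p x) = g (p x) := by rw [← hF, ← hG, hx]
  refine ⟨p x, hpx, ?_⟩
  ext y
  simp only [Set.mem_image, Set.mem_ofPred_eq, nielsenRelated_iff_homotopicRel]
  constructor
  · rintro ⟨_, ⟨w', rfl, rfl, -, h⟩, rfl⟩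
    exact ⟨(ContinuousMap.mk p hp.continuous).comp w', rfl, rfl, hpx,
      (hcomp w' _ rfl hx).1 h⟩
  · rintro ⟨w, hw0, rfl, -, h⟩
    obtain ⟨w', hw', rfl⟩ := hp.exists_path_lifts w x hw0
    exact ⟨w' 1, ⟨w', rfl, rfl, hx, (hcomp w' w hw' hx).2 h⟩, congrFun hw' 1⟩
end

section
/- Let p : M̃ → M and q : Ñ → N be covering maps, f, g : M → N continuous, and f̃, g̃ : M̃ → Ñ lifts of f and g. If x₀, x₁ ∈ Coin(f, g) are Nielsen related (for the pair (f, g)), then there is a bijection between the sets p⁻¹(x₀) ∩ Coin(f̃, g̃) and p⁻¹(x₁) ∩ Coin(f̃, g̃). -/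
open unitInterval in
/-- If two paths in the total space of a covering have images which are homotopic relative to
their endpoints, then they agree at the source if and only if they agree at the target. -/
theorem IsCoveringMap.apply_zero_eq_iff_apply_one_eq {E X : Type*} [TopologicalSpace E]
    [TopologicalSpace X] {q : E → X} (hq : IsCoveringMap q) {Γ₀ Γ₁ : C(I, E)}
    (h : (ContinuousMap.comp ⟨q, hq.continuous⟩ Γ₀).HomotopicRel
      (ContinuousMap.comp ⟨q, hq.continuous⟩ Γ₁) {0, 1}) :
    Γ₀ 0 = Γ₁ 0 ↔ Γ₀ 1 = Γ₁ 1 := by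
  have key : (∃ a ∈ ({0, 1} : Set I), Γ₀ a = Γ₁ a) → ∀ b ∈ ({0, 1} : Set I), Γ₀ b = Γ₁ b := by
    intro ha b hb
    obtain ⟨F⟩ := (hq.homotopicRel_iff_comp ha).mpr h
    exact (F.eq_fst 0 hb).symm.trans (F.eq_snd 0 hb)
  exact ⟨fun h₀ ↦ key ⟨0, .inl rfl, h₀⟩ 1 (.inr rfl), fun h₁ ↦ key ⟨1, .inr rfl, h₁⟩ 0 (.inl rfl)⟩

/-- If `x₀`, `x₁` are Nielsen related coincidence points of `(f, g)`, then the sets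
`p⁻¹(x₀) ∩ Coin(f', g')` and `p⁻¹(x₁) ∩ Coin(f', g')` are in bijection. -/
theorem stmt8 {M' M N' N : Type*} [TopologicalSpace M'] [TopologicalSpace M]
    [TopologicalSpace N'] [TopologicalSpace N]
    {p : M' → M} {q : N' → N} (hp : IsCoveringMap p) (hq : IsCoveringMap q)
    {f g : M → N} (hf : Continuous f) (hg : Continuous g)
    {f' g' : M' → N'} (hf' : Continuous f') (hg' : Continuous g')
    (hliftf : q ∘ f' = f ∘ p) (hliftg : q ∘ g' = g ∘ p)
    {x₀ x₁ : M} (hx₀ : f x₀ = g x₀) (hx₁ : f x₁ = g x₁)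
    (hrel : NielsenRelated hf hg x₀ x₁) :
    Nonempty ((↥(p ⁻¹' {x₀} ∩ {x : M' | f' x = g' x})) ≃
      (↥(p ⁻¹' {x₁} ∩ {x : M' | f' x = g' x}))) := by
  obtain ⟨hx, hy, w, hw⟩ := hrel
  let m := hp.monodromy (Path.Homotopic.Quotient.mk w)
  have hm : ∀ e : p ⁻¹' {x₀}, f' e = g' e ↔ f' (m e) = g' (m e) := by
    intro e
    have he : w 0 = p e := w.source.trans e.2.symm
    let Γ := hp.liftPath w e he
    have hΓ : ∀ t, p (Γ t) = w t := congrFun (hp.liftPath_lifts w e he)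
    have hΓ₀ : Γ 0 = e := hp.liftPath_zero w e he
    have hfΓ : ContinuousMap.comp ⟨q, hq.continuous⟩ (.comp ⟨f', hf'⟩ Γ) =
        (w.map hf).toContinuousMap :=
      ContinuousMap.ext fun t ↦ (congrFun hliftf (Γ t)).trans (congrArg f (hΓ t))
    have hgΓ : ContinuousMap.comp ⟨q, hq.continuous⟩ (.comp ⟨g', hg'⟩ Γ) =
        ((w.map hg).cast hx hy).toContinuousMap :=
      ContinuousMap.ext fun t ↦ (congrFun hliftg (Γ t)).trans (congrArg g (hΓ t))
    have key := hq.apply_zero_eq_iff_apply_one_eq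
      (Γ₀ := .comp ⟨f', hf'⟩ Γ) (Γ₁ := .comp ⟨g', hg'⟩ Γ) (by rw [hfΓ, hgΓ]; exact hw)
    change f' (Γ 0) = g' (Γ 0) ↔ f' (Γ 1) = g' (Γ 1) at key
    rwa [hΓ₀] at key
  exact ⟨(Equiv.subtypeSubtypeEquivSubtypeInter (· ∈ p ⁻¹' {x₀}) fun x ↦ f' x = g' x).symm.trans <|
    ((Equiv.ofBijective m (hp.monodromy_bijective _)).subtypeEquiv hm).trans <|
    Equiv.subtypeSubtypeEquivSubtypeInter (· ∈ p ⁻¹' {x₁}) fun x ↦ f' x = g' x⟩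
end

section
/- Let p : M̃ → M and q : Ñ → N be covering maps with M̃ and Ñ preconnected, f, g : M → N continuous, and f̃, g̃ : M̃ → Ñ lifts of f and g. Assume the deck transformation group of q acts transitively on every fiber of q. Let x₀ ∈ Coin(f, g) and assume the deck transformation group of p acts transitively on the fiber p⁻¹(x₀). Then any two equivalence classes of the restriction of the Nielsen relation of (f̃, g̃) to the set p⁻¹(x₀) ∩ Coin(f̃, g̃) have the same cardinality. -/
theorem Path.Homotopic.congr_fun {X : Type*} [TopologicalSpace X] {a b a' b' : X}
    {u v : Path a b} {u' v' : Path a' b'} (h : u.Homotopic v)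
    (hu : ∀ t, u t = u' t) (hv : ∀ t, v t = v' t) : u'.Homotopic v' := by
  obtain rfl : a = a' := by simpa using hu 0
  obtain rfl : b = b' := by simpa using hu 1
  obtain rfl : u = u' := Path.ext (funext hu)
  obtain rfl : v = v' := Path.ext (funext hv)
  exact h

/-- The Nielsen relation is preserved by a self-map `γ` of the domain that is intertwined with a
self-map `β` of the codomain by both maps of the pair. -/
theorem NielsenRelated.map {X Y : Type*} [TopologicalSpace X] [TopologicalSpace Y]
    {f g : X → Y} {hf : Continuous f} {hg : Continuous g} {γ : X → X} {β : Y → Y}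
    (hγ : Continuous γ) (hβ : Continuous β)
    (hfγ : ∀ x, β (f x) = f (γ x)) (hgγ : ∀ x, β (g x) = g (γ x)) {x y : X}
    (h : NielsenRelated hf hg x y) : NielsenRelated hf hg (γ x) (γ y) := by
  obtain ⟨hx, hy, w, hw⟩ := h
  refine ⟨by rw [← hfγ, ← hgγ, hx], by rw [← hfγ, ← hgγ, hy], w.map hγ, ?_⟩
  exact (hw.map ⟨β, hβ⟩).congr_fun (fun t => hfγ (w t)) (fun t => hgγ (w t))

/-- A deck transformation of the codomain covering that agrees at one point with a deck
transformation of the domain covering along a lift is intertwined with it everywhere. -/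
theorem IsDeckTransformation.comp_lift_eq {M' M N' N : Type*} [TopologicalSpace M']
    [TopologicalSpace M] [TopologicalSpace N'] [TopologicalSpace N] [PreconnectedSpace M']
    {p : M' → M} {q : N' → N} (hq : IsCoveringMap q) {f : M → N} {f' : M' → N'}
    (hf' : Continuous f') (hlift : q ∘ f' = f ∘ p) {γ : M' ≃ₜ M'} {β : N' ≃ₜ N'}
    (hγ : IsDeckTransformation p γ) (hβ : IsDeckTransformation q β) {x : M'}
    (hx : β (f' x) = f' (γ x)) (z : M') : β (f' z) = f' (γ z) := by
  have hl : ∀ z, q (f' z) = f (p z) := fun z => congrFun hlift z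
  refine congrFun (hq.eq_of_comp_eq (β.continuous.comp hf') (hf'.comp γ.continuous) ?_ x hx) z
  funext z
  simp [hl, hβ (f' z), hγ z]

/-- Corollary 3.6 (numsam): with `M'`, `N'` preconnected, the deck group of `q` transitive
on every fiber of `q`, `x₀` a coincidence point of `(f, g)`, and the deck group of `p`
transitive on the fiber `p⁻¹(x₀)`, any two equivalence classes of the restriction of the
Nielsen relation of the lifts `(f', g')` to `p⁻¹(x₀) ∩ Coin(f', g')` have the same
cardinality. -/
theorem stmt9 {M' M N' N : Type*} [TopologicalSpace M'] [TopologicalSpace M]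
    [TopologicalSpace N'] [TopologicalSpace N]
    [PreconnectedSpace M'] [PreconnectedSpace N']
    {p : M' → M} {q : N' → N} (hp : IsCoveringMap p) (hq : IsCoveringMap q)
    {f g : M → N} (hf : Continuous f) (hg : Continuous g)
    {f' g' : M' → N'} (hf' : Continuous f') (hg' : Continuous g')
    (hliftf : q ∘ f' = f ∘ p) (hliftg : q ∘ g' = g ∘ p)
    (hqtrans : ∀ y y' : N', q y = q y' →
      ∃ β : N' ≃ₜ N', IsDeckTransformation q β ∧ β y = y')
    {x₀ : M} (hx₀ : f x₀ = g x₀)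
    (hptrans : ∀ x x' : M', p x = x₀ → p x' = x₀ →
      ∃ γ : M' ≃ₜ M', IsDeckTransformation p γ ∧ γ x = x') :
    ∀ x y : M',
      x ∈ p ⁻¹' {x₀} ∩ {z : M' | f' z = g' z} →
      y ∈ p ⁻¹' {x₀} ∩ {z : M' | f' z = g' z} →
      Nonempty
        ((↥{z : M' | z ∈ p ⁻¹' {x₀} ∩ {w : M' | f' w = g' w} ∧ NielsenRelated hf' hg' x z}) ≃
         (↥{z : M' | z ∈ p ⁻¹' {x₀} ∩ {w : M' | f' w = g' w} ∧ NielsenRelated hf' hg' y z})) := by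
  rintro x y ⟨hxp, hxc⟩ ⟨hyp, hyc⟩
  simp only [Set.mem_preimage, Set.mem_singleton_iff, Set.mem_ofPred_eq] at hxp hxc hyp hyc
  obtain ⟨γ, hγ, rfl⟩ := hptrans x y hxp hyp
  have hl : ∀ z, q (f' z) = f (p z) := fun z => congrFun hliftf z
  obtain ⟨β, hβ, hβx⟩ := hqtrans (f' x) (f' (γ x)) (by rw [hl, hl, hγ])
  have hfγ := hγ.comp_lift_eq hq hf' hliftf hβ hβx
  have hgγ := hγ.comp_lift_eq hq hg' hliftg hβ (x := x) (by rw [← hxc, ← hyc, hβx])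
  have hfγs : ∀ z, β.symm (f' z) = f' (γ.symm z) := fun z => by
    rw [Homeomorph.symm_apply_eq, hfγ, γ.apply_symm_apply]
  have hgγs : ∀ z, β.symm (g' z) = g' (γ.symm z) := fun z => by
    rw [Homeomorph.symm_apply_eq, hgγ, γ.apply_symm_apply]
  refine ⟨γ.toEquiv.subtypeEquiv fun z => ?_⟩
  have hrel : NielsenRelated hf' hg' x z ↔ NielsenRelated hf' hg' (γ x) (γ z) :=
    ⟨fun h => h.map γ.continuous β.continuous hfγ hgγ, fun h => by
      simpa using h.map γ.symm.continuous β.symm.continuous hfγs hgγs⟩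
  simp [hrel, hγ z, ← hfγ, ← hgγ]
end

section
/- Let f, g : M → N be continuous maps of topological spaces and let x₀, x₁ ∈ M satisfy f(x₀) = g(x₀) and f(x₁) = g(x₁). Let α be a loop in M based at x₀ such that f ∘ α and g ∘ α are path-homotopic, and assume the path-homotopy class [f ∘ α] commutes with every element of the fundamental group π₁(N, f(x₀)) (i.e. [f ∘ α] lies in the center). Then for every path β in M from x₁ to x₀, the loop β · α · β⁻¹ based at x₁ (concatenation of β, then α, then the reverse of β) satisfies: f ∘ (β · α · β⁻¹) and g ∘ (β · α · β⁻¹) are path-homotopic. -/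
open CategoryTheory in
/-- In a groupoid, conjugating a central automorphism does not depend on the conjugating
morphism. -/
theorem CategoryTheory.Groupoid.conj_eq_conj_of_central {C : Type*} [Groupoid C] {x y : C}
    (a : x ⟶ x) (ha : ∀ d : x ⟶ x, a ≫ d = d ≫ a) (b c : y ⟶ x) :
    (b ≫ a) ≫ Groupoid.inv b = (c ≫ a) ≫ Groupoid.inv c := by
  have h := congrArg (fun t => c ≫ t ≫ Groupoid.inv b) (ha (Groupoid.inv c ≫ b))
  simpa using h.symm

/-- Conjugating a loop with central homotopy class does not depend, up to homotopy, on the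
conjugating path. -/
theorem Path.Homotopic.conj_of_central {X : Type*} [TopologicalSpace X] {x y : X}
    (a : Path x x) (ha : ∀ d : Path x x, (a.trans d).Homotopic (d.trans a)) (b c : Path y x) :
    ((b.trans a).trans b.symm).Homotopic ((c.trans a).trans c.symm) := by
  refine Path.Homotopic.Quotient.exact ?_
  refine CategoryTheory.Groupoid.conj_eq_conj_of_central
    (x := FundamentalGroupoid.mk x) (y := FundamentalGroupoid.mk y)
    (Path.Homotopic.Quotient.mk a) (fun d => ?_)
    (Path.Homotopic.Quotient.mk b) (Path.Homotopic.Quotient.mk c)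
  obtain ⟨d, rfl⟩ := Path.Homotopic.Quotient.mk_surjective d
  exact Path.Homotopic.Quotient.eq.2 (ha d)


/-- The computation behind Lemma 4.4 (loopcen): let `f`, `g` be continuous maps with
coincidence points `x₀`, `x₁`, and let `α` be a loop at `x₀` such that `f ∘ α` and `g ∘ α`
are path-homotopic and the homotopy class of `f ∘ α` commutes with every element of
`π₁(N, f x₀)`. Then for every path `β` from `x₁` to `x₀`, the loop `β · α · β⁻¹` at `x₁`
satisfies that `f ∘ (β · α · β⁻¹)` and `g ∘ (β · α · β⁻¹)` are path-homotopic. -/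
theorem stmt10 {M N : Type*} [TopologicalSpace M] [TopologicalSpace N]
    {f g : M → N} (hf : Continuous f) (hg : Continuous g)
    {x₀ x₁ : M} (hx₀ : f x₀ = g x₀) (hx₁ : f x₁ = g x₁)
    (α : Path x₀ x₀) (hα : (α.map hf).Homotopic ((α.map hg).cast hx₀ hx₀))
    (hcenter : ∀ δ : Path (f x₀) (f x₀),
      ((α.map hf).trans δ).Homotopic (δ.trans (α.map hf))) :
    ∀ β : Path x₁ x₀,
      (((β.trans α).trans β.symm).map hf).Homotopic
        ((((β.trans α).trans β.symm).map hg).cast hx₁ hx₁) := by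
  intro β
  let c : Path (f x₁) (f x₀) := (β.map hg).cast hx₁ hx₀
  have hcast : (((β.trans α).trans β.symm).map hg).cast hx₁ hx₁ =
      (c.trans ((α.map hg).cast hx₀ hx₀)).trans c.symm := by
    rw [Path.map_trans, Path.map_trans, ← Path.map_symm]
    rfl
  rw [hcast, Path.map_trans, Path.map_trans, ← Path.map_symm]
  exact (Path.Homotopic.conj_of_central (α.map hf) hcenter (β.map hf) c).trans
    (((Path.Homotopic.refl c).hcomp hα).hcomp (Path.Homotopic.refl c.symm))
end
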